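/- arXiv:2004.09692 — 2 statements merged into one kernel-verified Lean document; each statement's English description precedes it below -/
import Mathlib

section
/- Let (X,S) be an association scheme, x ∈ X, s ∈ S, and K a field. Let J ∈ M_X(K) denote the all-ones matrix. Then (E_s* J E_s*)² = n_s · (E_s* J E_s*) in M_X(K), where n_s = |xs| is the valency of s. Consequently, if K has positive characteristic p and p divides n_s, then the nonzero element E_s* J E_s* spans a nonzero nilpotent two-sided ideal of the corner algebra E_s*(KT(x))E_s*. -/
open Matrix

/-- An association scheme on a finite set `X`: a partition `S` of `X × X` into nonempty
relations containing the diagonal, closed under transposition, with intersection numbers. -/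
structure AssocScheme (X : Type*) [Fintype X] [DecidableEq X] where
  S : Finset (Finset (X × X))
  nonempty_mem : ∀ s ∈ S, s.Nonempty
  exists_unique_mem : ∀ p : X × X, ∃! s, s ∈ S ∧ p ∈ s
  diag_mem : Finset.univ.filter (fun p : X × X => p.1 = p.2) ∈ S
  star_mem : ∀ s ∈ S, s.image (fun p : X × X => (p.2, p.1)) ∈ S
  pnum : Finset (X × X) → Finset (X × X) → Finset (X × X) → ℕ
  card_eq_pnum : ∀ s ∈ S, ∀ t ∈ S, ∀ u ∈ S, ∀ y z : X, (y, z) ∈ u →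
      (Finset.univ.filter fun w => (y, w) ∈ s ∧ (w, z) ∈ t).card = pnum s t u

variable {X : Type*} [Fintype X] [DecidableEq X]

/-- The adjacency matrix `σ_s` of a relation `s ⊆ X × X`. -/
def adjMat (R : Type*) [Zero R] [One R] (s : Finset (X × X)) : Matrix X X R :=
  Matrix.of fun y z => if (y, z) ∈ s then 1 else 0

/-- The diagonal idempotent `E_s*` at the base point `x`. -/
def dualIdem (R : Type*) [Zero R] [One R] (x : X) (s : Finset (X × X)) : Matrix X X R :=
  Matrix.diagonal fun y => if (x, y) ∈ s then 1 else 0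

/-- The Terwilliger algebra `RT(x)`: the `R`-subalgebra of `M_X(R)` generated by
the matrices `E_s* σ_t E_u*` for `s, t, u ∈ S`. -/
def TerwAlg (R : Type*) [CommRing R] (A : AssocScheme X) (x : X) :
    Subalgebra R (Matrix X X R) :=
  Algebra.adjoin R {m | ∃ s ∈ A.S, ∃ t ∈ A.S, ∃ u ∈ A.S,
    m = dualIdem R x s * adjMat R t * dualIdem R x u}

/-- The indicator vector of `xs = {y | (x, y) ∈ s}`. -/
def classInd (R : Type*) [Zero R] [One R] (x : X) (s : Finset (X × X)) : X → R :=
  fun y => if (x, y) ∈ s then 1 else 0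

/-- The vectors that are constant on each of the sets `xs`, `s ∈ S`. -/
def classFun (R : Type*) [CommRing R] (A : AssocScheme X) (x : X) : Submodule R (X → R) where
  carrier := {f | ∀ s ∈ A.S, ∀ y z, (x, y) ∈ s → (x, z) ∈ s → f y = f z}
  add_mem' hf hg s hs y z hy hz := by
    simp [hf s hs y z hy hz, hg s hs y z hy hz]
  zero_mem' _ _ _ _ _ _ := rfl
  smul_mem' c f hf s hs y z hy hz := by
    simp [hf s hs y z hy hz]

theorem classInd_mem_classFun (R : Type*) [CommRing R] (A : AssocScheme X) (x : X)
    {s : Finset (X × X)} (hs : s ∈ A.S) : classInd R x s ∈ classFun R A x := by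
  intro t ht y z hy hz
  have key : ∀ a b : X, (x, a) ∈ t → (x, b) ∈ t → (x, a) ∈ s → (x, b) ∈ s := by
    intro a b ha hb has
    rwa [(A.exists_unique_mem (x, a)).unique ⟨hs, has⟩ ⟨ht, ha⟩]
  simp only [classInd, show (x, y) ∈ s ↔ (x, z) ∈ s from ⟨key y z hy hz, key z y hz hy⟩]

theorem dualIdem_mulVec (R : Type*) [CommRing R] (x : X) (s : Finset (X × X)) (f : X → R) :
    dualIdem R x s *ᵥ f = fun y => classInd R x s y * f y := by
  funext y
  simp [dualIdem, classInd, mulVec_diagonal]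

/-- `E_s*` sends a vector constant on the classes to a multiple of the indicator of `xs`. -/
theorem exists_dualIdem_mulVec_eq_smul (R : Type*) [CommRing R] (A : AssocScheme X) (x : X)
    {s : Finset (X × X)} (hs : s ∈ A.S) {f : X → R} (hf : f ∈ classFun R A x) :
    ∃ c : R, dualIdem R x s *ᵥ f = c • classInd R x s := by
  rw [dualIdem_mulVec]
  by_cases h : ∃ y, (x, y) ∈ s
  · obtain ⟨y, hy⟩ := h
    refine ⟨f y, funext fun z => ?_⟩
    by_cases hz : (x, z) ∈ s
    · simp [classInd, hz, hf s hs z y hz hy]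
    · simp [classInd, hz]
  · push Not at h
    exact ⟨0, funext fun z => by simp [classInd, h z]⟩

theorem adjMat_mulVec_classInd_mem_classFun (R : Type*) [CommRing R] (A : AssocScheme X) (x : X)
    {t u : Finset (X × X)} (ht : t ∈ A.S) (hu : u ∈ A.S) :
    adjMat R t *ᵥ classInd R x u ∈ classFun R A x := by
  have key : ∀ s ∈ A.S, ∀ y, (x, y) ∈ s → (adjMat R t *ᵥ classInd R x u) y =
      (A.pnum u (t.image fun p : X × X => (p.2, p.1)) s : R) := by
    intro s hs y hy
    rw [← A.card_eq_pnum u hu _ (A.star_mem t ht) s hs x y hy]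
    simp [mulVec, dotProduct, adjMat, classInd, Finset.filter_and, ← ite_and, and_comm]
  intro s hs y z hy hz
  rw [key s hs y hy, key s hs z hz]

theorem mulVec_mem_classFun (R : Type*) [CommRing R] (A : AssocScheme X) (x : X)
    {a : Matrix X X R} (ha : a ∈ TerwAlg R A x) {f : X → R} (hf : f ∈ classFun R A x) :
    a *ᵥ f ∈ classFun R A x := by
  induction ha using Algebra.adjoin_induction generalizing f with
  | mem m hm =>
    obtain ⟨s, hs, t, ht, u, hu, rfl⟩ := hm
    obtain ⟨c, hc⟩ := exists_dualIdem_mulVec_eq_smul R A x hu hf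
    obtain ⟨d, hd⟩ := exists_dualIdem_mulVec_eq_smul R A x hs
      (adjMat_mulVec_classInd_mem_classFun R A x ht hu)
    rw [← mulVec_mulVec, ← mulVec_mulVec, hc, mulVec_smul, mulVec_smul, hd]
    exact Submodule.smul_mem _ _ (Submodule.smul_mem _ _ (classInd_mem_classFun R A x hs))
  | algebraMap r =>
    rw [Algebra.algebraMap_eq_smul_one, smul_mulVec, one_mulVec]
    exact Submodule.smul_mem _ _ hf
  | add a b _ _ iha ihb =>
    rw [add_mulVec]
    exact Submodule.add_mem _ (iha hf) (ihb hf)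
  | mul a b _ _ iha ihb =>
    rw [← mulVec_mulVec]
    exact iha (ihb hf)

theorem transpose_dualIdem (R : Type*) [CommRing R] (x : X) (s : Finset (X × X)) :
    (dualIdem R x s)ᵀ = dualIdem R x s :=
  diagonal_transpose _

theorem transpose_adjMat (R : Type*) [CommRing R] (t : Finset (X × X)) :
    (adjMat R t)ᵀ = adjMat R (t.image fun p : X × X => (p.2, p.1)) := by
  ext y z
  simp [adjMat]

theorem transpose_mem_TerwAlg (R : Type*) [CommRing R] (A : AssocScheme X) (x : X)
    {a : Matrix X X R} (ha : a ∈ TerwAlg R A x) : aᵀ ∈ TerwAlg R A x := by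
  induction ha using Algebra.adjoin_induction with
  | mem m hm =>
    obtain ⟨s, hs, t, ht, u, hu, rfl⟩ := hm
    refine Algebra.subset_adjoin ⟨u, hu, _, A.star_mem t ht, s, hs, ?_⟩
    simp only [transpose_mul, transpose_dualIdem, transpose_adjMat, mul_assoc]
  | algebraMap r =>
    rw [Algebra.algebraMap_eq_smul_one, transpose_smul, transpose_one,
      ← Algebra.algebraMap_eq_smul_one]
    exact Subalgebra.algebraMap_mem _ r
  | add a b _ _ iha ihb =>
    rw [transpose_add]
    exact Subalgebra.add_mem _ iha ihb
  | mul a b _ _ iha ihb =>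
    rw [transpose_mul]
    exact Subalgebra.mul_mem _ ihb iha

theorem dualIdem_mul_ones_mul_dualIdem (R : Type*) [CommRing R] (x : X) (s : Finset (X × X)) :
    dualIdem R x s * Matrix.of (fun _ _ => (1 : R)) * dualIdem R x s =
      vecMulVec (classInd R x s) (classInd R x s) := by
  ext y z
  simp [dualIdem, classInd, vecMulVec_apply]

theorem exists_corner_mulVec_eq_smul (R : Type*) [CommRing R] (A : AssocScheme X) (x : X)
    {s : Finset (X × X)} (hs : s ∈ A.S) {a : Matrix X X R} (ha : a ∈ TerwAlg R A x) :
    ∃ c : R, (dualIdem R x s * a * dualIdem R x s) *ᵥ classInd R x s = c • classInd R x s := by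
  have h : dualIdem R x s *ᵥ classInd R x s = classInd R x s := by
    funext y
    by_cases hy : (x, y) ∈ s <;> simp [dualIdem_mulVec, classInd, hy]
  rw [← mulVec_mulVec, h, ← mulVec_mulVec]
  exact exists_dualIdem_mulVec_eq_smul R A x hs
    (mulVec_mem_classFun R A x ha (classInd_mem_classFun R A x hs))

theorem AssocScheme.exists_mem_of_mem (A : AssocScheme X) (x : X) {s : Finset (X × X)}
    (hs : s ∈ A.S) : ∃ y, (x, y) ∈ s := by
  obtain ⟨⟨y, z⟩, hyz⟩ := A.nonempty_mem s hs
  have h := fun w => A.card_eq_pnum s hs _ (A.star_mem s hs) _ A.diag_mem w w (by simp)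
  have hpos : 0 < (Finset.univ.filter fun w => (y, w) ∈ s ∧
      (w, y) ∈ s.image fun p : X × X => (p.2, p.1)).card :=
    Finset.card_pos.mpr ⟨z, by simpa using hyz⟩
  rw [h y, ← h x] at hpos
  obtain ⟨w, hw⟩ := Finset.card_pos.mp hpos
  exact ⟨w, (Finset.mem_filter.mp hw).2.1⟩

/-- **Lemma.** `(E_s* J E_s*)² = n_s · (E_s* J E_s*)`, where `J` is the all-ones matrix and
`n_s = |xs|` is the valency of `s`.  Consequently, if `char K = p > 0` divides `n_s`, then
the nonzero element `E_s* J E_s*` spans a nonzero nilpotent two-sided ideal of the corner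
algebra `E_s* (KT(x)) E_s*`. -/
theorem EJE_sq_eq_valency_smul (A : AssocScheme X) (x : X) (s : Finset (X × X))
    (hs : s ∈ A.S) (K : Type*) [Field K] :
    (dualIdem K x s * Matrix.of (fun _ _ => (1 : K)) * dualIdem K x s) *
        (dualIdem K x s * Matrix.of (fun _ _ => (1 : K)) * dualIdem K x s)
      = (((Finset.univ.filter fun y => (x, y) ∈ s).card : K) •
          (dualIdem K x s * Matrix.of (fun _ _ => (1 : K)) * dualIdem K x s)) ∧
    (∀ p : ℕ, p ≠ 0 → CharP K p →
      p ∣ (Finset.univ.filter fun y => (x, y) ∈ s).card →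
      dualIdem K x s * Matrix.of (fun _ _ => (1 : K)) * dualIdem K x s ≠ 0 ∧
      (dualIdem K x s * Matrix.of (fun _ _ => (1 : K)) * dualIdem K x s) *
          (dualIdem K x s * Matrix.of (fun _ _ => (1 : K)) * dualIdem K x s) = 0 ∧
      ∀ a ∈ TerwAlg K A x,
        (dualIdem K x s * a * dualIdem K x s) *
            (dualIdem K x s * Matrix.of (fun _ _ => (1 : K)) * dualIdem K x s)
          ∈ Submodule.span K
            {dualIdem K x s * Matrix.of (fun _ _ => (1 : K)) * dualIdem K x s} ∧
        (dualIdem K x s * Matrix.of (fun _ _ => (1 : K)) * dualIdem K x s) *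
            (dualIdem K x s * a * dualIdem K x s)
          ∈ Submodule.span K
            {dualIdem K x s * Matrix.of (fun _ _ => (1 : K)) * dualIdem K x s}) := by
  have hsq : vecMulVec (classInd K x s) (classInd K x s) *
      vecMulVec (classInd K x s) (classInd K x s) =
      ((Finset.univ.filter fun y => (x, y) ∈ s).card : K) •
        vecMulVec (classInd K x s) (classInd K x s) := by
    rw [vecMulVec_mul_vecMulVec]
    ext y z
    simp [dotProduct, classInd, vecMulVec_apply, ← ite_and]
  simp only [dualIdem_mul_ones_mul_dualIdem]
  refine ⟨hsq, fun p _ _ hdvd => ⟨fun h0 => ?_, ?_, fun a ha => ⟨?_, ?_⟩⟩⟩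
  · obtain ⟨y, hy⟩ := A.exists_mem_of_mem x hs
    simpa [vecMulVec_apply, classInd, hy] using congrFun (congrFun h0 y) y
  · rw [hsq, (CharP.cast_eq_zero_iff K p _).mpr hdvd, zero_smul]
  · obtain ⟨c, hc⟩ := exists_corner_mulVec_eq_smul K A x hs ha
    rw [mul_vecMulVec, hc, smul_vecMulVec]
    exact Submodule.smul_mem _ c (Submodule.mem_span_singleton_self _)
  · obtain ⟨c, hc⟩ := exists_corner_mulVec_eq_smul K A x hs (transpose_mem_TerwAlg K A x ha)
    have ht : (dualIdem K x s * aᵀ * dualIdem K x s) = (dualIdem K x s * a * dualIdem K x s)ᵀ := by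
      simp only [transpose_mul, transpose_dualIdem, mul_assoc]
    rw [ht, mulVec_transpose] at hc
    rw [vecMulVec_mul, hc, vecMulVec_smul]
    exact Submodule.smul_mem _ c (Submodule.mem_span_singleton_self _)
end

section
/- Let n ≥ 5 and let (X,S) be the Johnson scheme J(n,2) with fixed point x = {1,2}. Then in M_X(ℤ) the following identities hold: (E₁*σ₁E₁*)·(E₁*σ₂E₁*) = E₁*σ₁E₁* + (n−4)·E₁*σ₂E₁* + (n−4)·M, and (E₁*σ₂E₁*)·(E₁*σ₁E₁*) = E₁*σ₁E₁* + (n−4)·E₁*σ₂E₁* + (n−4)·M. -/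
open Matrix

/-- The point set of the Johnson scheme `J(n,2)`: 2-element subsets of an `n`-set. -/
abbrev JPoint (n : ℕ) : Type := {A : Finset (Fin n) // A.card = 2}

/-- The base point `x = {1,2}` (the indices `0` and `1` of `Fin n`). -/
def Jx (n : ℕ) (hn : 2 ≤ n) : JPoint n :=
  ⟨{(⟨0, by omega⟩ : Fin n), (⟨1, by omega⟩ : Fin n)},
    Finset.card_pair (by simp [Fin.ext_iff])⟩

/-- The adjacency matrices `σ₀, σ₁, σ₂` of the relations of `J(n,2)`:
`(y,z) ∈ s₀ ↔ y = z`, `(y,z) ∈ s₁ ↔ |y ∩ z| = 1`, `(y,z) ∈ s₂ ↔ y ∩ z = ∅`. -/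
def Jσ (R : Type*) [Zero R] [One R] (n : ℕ) (j : Fin 3) : Matrix (JPoint n) (JPoint n) R :=
  Matrix.of fun y z =>
    if j = 0 then (if y = z then 1 else 0)
    else if j = 1 then (if (y.1 ∩ z.1).card = 1 then 1 else 0)
    else if y.1 ∩ z.1 = ∅ then 1 else 0

/-- The diagonal matrices `E₀*, E₁*, E₂*` at the base point `x = {1,2}`. -/
def JE (R : Type*) [Zero R] [One R] (n : ℕ) (hn : 2 ≤ n) (i : Fin 3) :
    Matrix (JPoint n) (JPoint n) R :=
  Matrix.diagonal fun y =>
    if i = 0 then (if Jx n hn = y then 1 else 0)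
    else if i = 1 then (if ((Jx n hn).1 ∩ y.1).card = 1 then 1 else 0)
    else if (Jx n hn).1 ∩ y.1 = ∅ then 1 else 0

/-- The matrix `M`: its `(y,z)`-entry is `1` iff `y = {1,i}, z = {2,i}` or
`y = {2,i}, z = {1,i}` for some `i ≥ 3` (indices `0`, `1` and `c ≥ 2` in `Fin n`). -/
def JM (R : Type*) [Zero R] [One R] (n : ℕ) (hn : 2 ≤ n) : Matrix (JPoint n) (JPoint n) R :=
  Matrix.of fun y z =>
    if ∃ c : Fin n, 2 ≤ c.val ∧
        ((y.1 = {⟨0, by omega⟩, c} ∧ z.1 = {⟨1, by omega⟩, c}) ∨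
         (y.1 = {⟨1, by omega⟩, c} ∧ z.1 = {⟨0, by omega⟩, c})) then 1 else 0

/-- The Terwilliger algebra `RT(x)` of the Johnson scheme `J(n,2)` at `x = {1,2}`:
the `R`-subalgebra of `M_X(R)` generated by the matrices `E_i* σ_j E_k*`. -/
def JT (R : Type*) [CommRing R] (n : ℕ) (hn : 2 ≤ n) :
    Subalgebra R (Matrix (JPoint n) (JPoint n) R) :=
  Algebra.adjoin R {m | ∃ i j k : Fin 3, m = JE R n hn i * Jσ R n j * JE R n hn k}

open scoped Kronecker in
/-- On the `2 × ι` grid, the product of the graph `a = b, c ≠ d` or `a ≠ b, c = d` with the graph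
`a ≠ b, c ≠ d`, written with `P` the swap and `J` the all-ones matrix. -/
theorem grid_mul {ι : Type*} [Fintype ι] [DecidableEq ι] (P : Matrix Bool Bool ℤ)
    (hP : P * P = 1) (J : Matrix ι ι ℤ) (hJ : J * J = (Fintype.card ι : ℤ) • J) :
    (1 ⊗ₖ (J - 1) + P ⊗ₖ 1) * (P ⊗ₖ (J - 1)) =
        (1 ⊗ₖ (J - 1) + P ⊗ₖ 1) + ((Fintype.card ι : ℤ) - 2) • (P ⊗ₖ (J - 1)) +
          ((Fintype.card ι : ℤ) - 2) • (P ⊗ₖ (1 : Matrix ι ι ℤ)) ∧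
      (P ⊗ₖ (J - 1)) * (1 ⊗ₖ (J - 1) + P ⊗ₖ 1) =
        (1 ⊗ₖ (J - 1) + P ⊗ₖ 1) + ((Fintype.card ι : ℤ) - 2) • (P ⊗ₖ (J - 1)) +
          ((Fintype.card ι : ℤ) - 2) • (P ⊗ₖ (1 : Matrix ι ι ℤ)) := by
  have hK : (J - 1) * (J - 1) =
      ((Fintype.card ι : ℤ) - 2) • (J - 1) + ((Fintype.card ι : ℤ) - 1) • (1 : Matrix ι ι ℤ) := by
    rw [sub_mul, mul_sub, hJ]
    simp only [mul_one, one_mul]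
    module
  constructor
  · rw [add_mul, ← mul_kronecker_mul, ← mul_kronecker_mul, hK, hP]
    simp only [one_mul, kronecker_add, kronecker_smul]
    module
  · rw [mul_add, ← mul_kronecker_mul, ← mul_kronecker_mul, hK, hP]
    simp only [mul_one, kronecker_add, kronecker_smul]
    module

/-- An identity `B * C = D` between matrices supported on the range of an injection can be checked
on submatrices. -/
theorem Matrix.mul_eq_of_submatrix {X Y R : Type*} [Fintype X] [Fintype Y]
    [NonUnitalNonAssocSemiring R] (e : Y → X) (he : Function.Injective e) {B C D : Matrix X X R}
    (hB : ∀ y z, y ∉ Set.range e ∨ z ∉ Set.range e → B y z = 0)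
    (hC : ∀ y z, y ∉ Set.range e ∨ z ∉ Set.range e → C y z = 0)
    (hD : ∀ y z, y ∉ Set.range e ∨ z ∉ Set.range e → D y z = 0)
    (h : B.submatrix e e * C.submatrix e e = D.submatrix e e) : B * C = D := by
  ext y z
  rw [mul_apply]
  by_cases hy : y ∈ Set.range e
  · by_cases hz : z ∈ Set.range e
    · obtain ⟨p, rfl⟩ := hy
      obtain ⟨q, rfl⟩ := hz
      rw [← Fintype.sum_of_injective e he (fun r => B (e p) (e r) * C (e r) (e q)) _
        (fun w hw => by rw [hB _ _ (.inr hw), zero_mul]) (fun _ => rfl)]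
      exact congrFun (congrFun h p) q
    · rw [hD _ _ (.inr hz)]
      exact Finset.sum_eq_zero fun w _ => by rw [hC _ _ (.inr hz), mul_zero]
  · rw [hD _ _ (.inl hy)]
    exact Finset.sum_eq_zero fun w _ => by rw [hB _ _ (.inl hy), zero_mul]

/-- The parametrization of the neighbours `{a, c}` of `x = {1,2}`, with `a ∈ x` and `c ∉ x`. -/
def Jnbr (n : ℕ) (hn : 2 ≤ n) (p : Bool × {c : Fin n // 2 ≤ c.val}) : JPoint n :=
  ⟨{bif p.1 then ⟨1, by omega⟩ else ⟨0, by omega⟩, p.2.1}, Finset.card_pair (by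
    obtain ⟨a, c, hc⟩ := p
    cases a <;> simp [Fin.ext_iff] <;> omega)⟩

theorem Jnbr_injective (n : ℕ) (hn : 2 ≤ n) : Function.Injective (Jnbr n hn) := by
  rintro ⟨a, c, hc⟩ ⟨b, d, hd⟩ h
  have h' := congrArg Subtype.val h
  have h0 := Finset.ext_iff.1 h' ⟨0, by omega⟩
  have h2 := Finset.ext_iff.1 h' c
  simp only [Jnbr, Finset.mem_insert, Finset.mem_singleton] at h0 h2
  cases a <;> cases b <;> simp [Fin.ext_iff] at * <;> omega

theorem Finset.card_pair_inter_pair {α : Type*} [DecidableEq α] {a b c d : α} (hac : a ≠ c)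
    (had : a ≠ d) (hcb : c ≠ b) :
    (({a, c} : Finset α) ∩ {b, d}).card =
      (if a = b then 1 else 0) + (if c = d then 1 else 0) := by
  have h : ({a, c} : Finset α) ∩ {b, d} =
      (if a = b then {a} else ∅) ∪ (if c = d then {c} else ∅) := by grind
  rw [h]
  by_cases hab : a = b <;> by_cases hcd : c = d <;> simp [hab, hcd]
  exact Finset.card_pair (by grind)

theorem card_Jx_inter_eq_one_iff (n : ℕ) (hn : 2 ≤ n) (y : JPoint n) :
    ((Jx n hn).1 ∩ y.1).card = 1 ↔ y ∈ Set.range (Jnbr n hn) := by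
  constructor
  · obtain ⟨y, hy⟩ := y
    obtain ⟨a, b, hab, rfl⟩ := Finset.card_eq_two.1 hy
    intro h
    by_cases ha : 2 ≤ a.val <;> by_cases hb : 2 ≤ b.val
    · rw [Finset.disjoint_iff_inter_eq_empty.1] at h
      · simp at h
      · simp only [Jx, Finset.disjoint_insert_left, Finset.disjoint_singleton_left,
          Finset.mem_insert, Finset.mem_singleton, Fin.ext_iff]
        omega
    · obtain hb | hb : b.val = 0 ∨ b.val = 1 := by omega
      · exact ⟨(false, ⟨a, ha⟩), Subtype.ext (by simp [Jnbr, ← hb, Finset.pair_comm])⟩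
      · exact ⟨(true, ⟨a, ha⟩), Subtype.ext (by simp [Jnbr, ← hb, Finset.pair_comm])⟩
    · obtain ha | ha : a.val = 0 ∨ a.val = 1 := by omega
      · exact ⟨(false, ⟨b, hb⟩), Subtype.ext (by simp [Jnbr, ← ha])⟩
      · exact ⟨(true, ⟨b, hb⟩), Subtype.ext (by simp [Jnbr, ← ha])⟩
    · have hsub : ({a, b} : Finset (Fin n)) ⊆ (Jx n hn).1 := by
        intro i
        simp only [Jx, Finset.mem_insert, Finset.mem_singleton, Fin.ext_iff]
        omega
      rw [Finset.inter_eq_right.2 hsub] at h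
      omega
  · rintro ⟨⟨a, c, hc⟩, rfl⟩
    refine Finset.card_eq_one.2 ⟨bif a then ⟨1, by omega⟩ else ⟨0, by omega⟩, ?_⟩
    ext i
    cases a <;> simp [Jx, Jnbr, Fin.ext_iff] <;> omega

theorem card_Jnbr_inter (n : ℕ) (hn : 2 ≤ n) (p q : Bool × {c : Fin n // 2 ≤ c.val}) :
    ((Jnbr n hn p).1 ∩ (Jnbr n hn q).1).card =
      (if p.1 = q.1 then 1 else 0) + (if p.2 = q.2 then 1 else 0) := by
  obtain ⟨a, c, hc⟩ := p
  obtain ⟨b, d, hd⟩ := q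
  have key (a : Bool) {c : Fin n} (hc : 2 ≤ c.val) :
      (bif a then ⟨1, by omega⟩ else ⟨0, by omega⟩ : Fin n) ≠ c := by
    cases a <;> simp [Fin.ext_iff] <;> omega
  simp only [Jnbr]
  rw [Finset.card_pair_inter_pair (key a hc) (key a hd) (key b hc).symm]
  cases a <;> cases b <;> simp

theorem JE_mul_mul_JE_apply (n : ℕ) (hn : 2 ≤ n) (A : Matrix (JPoint n) (JPoint n) ℤ)
    (y z : JPoint n) [Decidable (y ∈ Set.range (Jnbr n hn) ∧ z ∈ Set.range (Jnbr n hn))] :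
    (JE ℤ n hn 1 * A * JE ℤ n hn 1) y z =
      if y ∈ Set.range (Jnbr n hn) ∧ z ∈ Set.range (Jnbr n hn) then A y z else 0 := by
  simp only [JE, mul_diagonal, diagonal_mul, card_Jx_inter_eq_one_iff]
  by_cases hy : y ∈ Set.range (Jnbr n hn) <;> by_cases hz : z ∈ Set.range (Jnbr n hn) <;>
    simp [hy, hz]

theorem JM_Jnbr (n : ℕ) (hn : 2 ≤ n) (p q : Bool × {c : Fin n // 2 ≤ c.val}) :
    JM ℤ n hn (Jnbr n hn p) (Jnbr n hn q) = if p.1 ≠ q.1 ∧ p.2 = q.2 then 1 else 0 := by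
  simp only [JM, of_apply]
  refine if_congr ?_ rfl rfl
  obtain ⟨b, d⟩ := q
  constructor
  · rintro ⟨c, hc, ⟨hy, hz⟩ | ⟨hy, hz⟩⟩
    · obtain rfl := Jnbr_injective n hn (a₂ := (false, ⟨c, hc⟩)) (Subtype.ext hy)
      cases Jnbr_injective n hn (a₂ := (true, ⟨c, hc⟩)) (Subtype.ext hz)
      simp
    · obtain rfl := Jnbr_injective n hn (a₂ := (true, ⟨c, hc⟩)) (Subtype.ext hy)
      cases Jnbr_injective n hn (a₂ := (false, ⟨c, hc⟩)) (Subtype.ext hz)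
      simp
  · obtain ⟨a, c, hc⟩ := p
    rintro ⟨hab, rfl⟩
    refine ⟨c, hc, ?_⟩
    cases a <;> cases b <;> simp [Jnbr] at hab ⊢

theorem JM_eq_zero (n : ℕ) (hn : 2 ≤ n) (y z : JPoint n)
    (h : y ∉ Set.range (Jnbr n hn) ∨ z ∉ Set.range (Jnbr n hn)) : JM ℤ n hn y z = 0 := by
  simp only [JM, of_apply]
  refine if_neg ?_
  rintro ⟨c, hc, ⟨hy, hz⟩ | ⟨hy, hz⟩⟩
  · exact h.elim (· ⟨(false, ⟨c, hc⟩), Subtype.ext hy.symm⟩)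
      (· ⟨(true, ⟨c, hc⟩), Subtype.ext hz.symm⟩)
  · exact h.elim (· ⟨(true, ⟨c, hc⟩), Subtype.ext hy.symm⟩)
      (· ⟨(false, ⟨c, hc⟩), Subtype.ext hz.symm⟩)

theorem card_two_le_fin (n : ℕ) (hn : 2 ≤ n) :
    (Fintype.card {c : Fin n // 2 ≤ c.val} : ℤ) = n - 2 := by
  have h := Fintype.card_subtype_compl (fun c : Fin n => c.val < 2)
  have h2 : Fintype.card {c : Fin n // c.val < 2} = 2 := by
    rw [Fintype.card_subtype]
    simp [-Order.lt_two_iff, Fin.card_filter_val_lt, hn]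
  simp only [not_lt, Fintype.card_fin, h2] at h
  rw [h]
  push_cast [hn]
  rfl

/-- **Identity.** In `M_X(ℤ)` for `J(n,2)` (`n ≥ 5`), `x = {1,2}`:
`(E₁*σ₁E₁*)(E₁*σ₂E₁*) = E₁*σ₁E₁* + (n−4)·E₁*σ₂E₁* + (n−4)·M`, and the same
for the product in the opposite order. -/
theorem johnson_E1s1E1_mul_E1s2E1 (n : ℕ) (hn : 5 ≤ n) :
    (JE ℤ n (by omega) 1 * Jσ ℤ n 1 * JE ℤ n (by omega) 1) *
        (JE ℤ n (by omega) 1 * Jσ ℤ n 2 * JE ℤ n (by omega) 1) =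
      (JE ℤ n (by omega) 1 * Jσ ℤ n 1 * JE ℤ n (by omega) 1) +
      ((n : ℤ) - 4) • (JE ℤ n (by omega) 1 * Jσ ℤ n 2 * JE ℤ n (by omega) 1) +
      ((n : ℤ) - 4) • JM ℤ n (by omega) ∧
    (JE ℤ n (by omega) 1 * Jσ ℤ n 2 * JE ℤ n (by omega) 1) *
        (JE ℤ n (by omega) 1 * Jσ ℤ n 1 * JE ℤ n (by omega) 1) =
      (JE ℤ n (by omega) 1 * Jσ ℤ n 1 * JE ℤ n (by omega) 1) +
      ((n : ℤ) - 4) • (JE ℤ n (by omega) 1 * Jσ ℤ n 2 * JE ℤ n (by omega) 1) +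
      ((n : ℤ) - 4) • JM ℤ n (by omega) := by
  classical
  have h2 : 2 ≤ n := by omega
  let ι := {c : Fin n // 2 ≤ c.val}
  let P : Matrix Bool Bool ℤ := of fun a b => if a = b then 0 else 1
  let J : Matrix ι ι ℤ := of fun _ _ => 1
  have hP : P * P = 1 := by decide
  have hJ : J * J = (Fintype.card ι : ℤ) • J := by
    ext c d
    simp [J, mul_apply]
  have hsupp (A : Matrix (JPoint n) (JPoint n) ℤ) (y z : JPoint n)
      (h : y ∉ Set.range (Jnbr n h2) ∨ z ∉ Set.range (Jnbr n h2)) :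
      (JE ℤ n h2 1 * A * JE ℤ n h2 1) y z = 0 := by
    rw [JE_mul_mul_JE_apply, if_neg (by tauto)]
  have h1 : (JE ℤ n h2 1 * Jσ ℤ n 1 * JE ℤ n h2 1).submatrix (Jnbr n h2) (Jnbr n h2) =
      kronecker 1 (J - 1) + kronecker P 1 := by
    ext ⟨a, c⟩ ⟨b, d⟩
    rw [submatrix_apply, JE_mul_mul_JE_apply, if_pos ⟨⟨_, rfl⟩, ⟨_, rfl⟩⟩]
    by_cases hab : a = b <;> by_cases hcd : c = d <;>
      simp [Jσ, card_Jnbr_inter, P, J, one_apply, hab, hcd, (Jnbr n h2 (b, d)).2]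
  have h2' : (JE ℤ n h2 1 * Jσ ℤ n 2 * JE ℤ n h2 1).submatrix (Jnbr n h2) (Jnbr n h2) =
      kronecker P (J - 1) := by
    ext ⟨a, c⟩ ⟨b, d⟩
    rw [submatrix_apply, JE_mul_mul_JE_apply, if_pos ⟨⟨_, rfl⟩, ⟨_, rfl⟩⟩]
    by_cases hab : a = b <;> by_cases hcd : c = d <;>
      simp [Jσ, ← Finset.card_eq_zero, card_Jnbr_inter, P, J, one_apply, hab, hcd,
        (Jnbr n h2 (b, d)).2]
  have hM : (JM ℤ n h2).submatrix (Jnbr n h2) (Jnbr n h2) = kronecker P 1 := by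
    ext ⟨a, c⟩ ⟨b, d⟩
    rw [submatrix_apply, JM_Jnbr]
    by_cases hab : a = b <;> by_cases hcd : c = d <;> simp [P, one_apply, hab, hcd]
  have hn4 : (n : ℤ) - 4 = (Fintype.card ι : ℤ) - 2 := by
    rw [card_two_le_fin n h2]
    ring
  have hsum (y z : JPoint n)
      (h : y ∉ Set.range (Jnbr n h2) ∨ z ∉ Set.range (Jnbr n h2)) :
      (JE ℤ n h2 1 * Jσ ℤ n 1 * JE ℤ n h2 1 +
        ((n : ℤ) - 4) • (JE ℤ n h2 1 * Jσ ℤ n 2 * JE ℤ n h2 1) +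
        ((n : ℤ) - 4) • JM ℤ n h2) y z = 0 := by
    simp only [Matrix.add_apply, Matrix.smul_apply, hsupp _ y z h, JM_eq_zero n h2 y z h,
      smul_zero, add_zero]
  constructor
  · refine mul_eq_of_submatrix _ (Jnbr_injective n h2) (hsupp _) (hsupp _) hsum ?_
    simp only [submatrix_add, submatrix_smul, Pi.add_apply, Pi.smul_apply, h1, h2', hM, hn4]
    exact (grid_mul P hP J hJ).1
  · refine mul_eq_of_submatrix _ (Jnbr_injective n h2) (hsupp _) (hsupp _) hsum ?_
    simp only [submatrix_add, submatrix_smul, Pi.add_apply, Pi.smul_apply, h1, h2', hM, hn4]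
    exact (grid_mul P hP J hJ).2
end
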